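/- Let A : 𝕋 ⥤ Type be a functor preserving finite products, and let X := A.obj 1 be equipped with the additive commutative group structure induced by A (addition via the matrix (1 1), zero via the unique morphism 0 ⟶ 1, negation via the matrix (−1)). Then A is naturally isomorphic to the functor X̂ : 𝕋 ⥤ Type associated to the group X, i.e. the functor n ↦ (Fin n → X) with integer matrices acting by (P · x) i = ∑ j, P i j • x j. A natural isomorphism is given in degree n by the map A.obj n → (Fin n → X) whose i-th component is A applied to the 1×n matrix with 1 in position i and 0 elsewhere. -/

import Mathlib

open CategoryTheory Limits

/-- The category `𝕋`: objects are natural numbers, morphisms `n ⟶ k` are `k × n`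
integer matrices, composition is matrix multiplication. -/
instance : Category ℕ where
  Hom n k := Matrix (Fin k) (Fin n) ℤ
  id n := (1 : Matrix (Fin n) (Fin n) ℤ)
  comp {n k m} P Q :=
    show Matrix (Fin m) (Fin n) ℤ from
      (show Matrix (Fin m) (Fin k) ℤ from Q) * (show Matrix (Fin k) (Fin n) ℤ from P)
  id_comp := by intros; exact Matrix.mul_one _
  comp_id := by intros; exact Matrix.one_mul _
  assoc := by intros; exact (Matrix.mul_assoc _ _ _).symm

/-- The block matrix `(I_n | 0) : (n+m) ⟶ n`. -/
def proj₁ (n m : ℕ) : Matrix (Fin n) (Fin (n + m)) ℤ :=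
  fun i j => if (j : ℕ) = (i : ℕ) then 1 else 0

/-- The block matrix `(0 | I_m) : (n+m) ⟶ m`. -/
def proj₂ (n m : ℕ) : Matrix (Fin m) (Fin (n + m)) ℤ :=
  fun i j => if (j : ℕ) = n + (i : ℕ) then 1 else 0

/-- The functor `Ĝ : 𝕋 ⥤ Type` associated to an additive commutative group `G`:
`n ↦ (Fin n → G)` on objects, integer matrices acting by `(P · x) i = ∑ j, P i j • x j`. -/
def hatF (G : Type) [AddCommGroup G] : ℕ ⥤ Type where
  obj n := Fin n → G
  map {n k} P := TypeCat.ofHom fun x => fun i => ∑ j, (show Matrix (Fin k) (Fin n) ℤ from P) i j • x j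
  map_id := by
    intro n
    apply ConcreteCategory.hom_ext
    intro x
    funext i
    show ∑ j, (1 : Matrix (Fin n) (Fin n) ℤ) i j • x j = x i
    simp [Matrix.one_apply]
  map_comp := by
    intro n k m P Q
    apply ConcreteCategory.hom_ext
    intro x
    funext i
    show ∑ j, ((show Matrix (Fin m) (Fin k) ℤ from Q) *
        (show Matrix (Fin k) (Fin n) ℤ from P)) i j • x j =
      ∑ l, (show Matrix (Fin m) (Fin k) ℤ from Q) i l •
        ∑ j, (show Matrix (Fin k) (Fin n) ℤ from P) l j • x j
    simp only [Matrix.mul_apply, Finset.sum_smul, Finset.smul_sum, mul_smul]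
    exact Finset.sum_comm

/-- The `1 × 2` matrix `(1 1)`, a morphism `2 ⟶ 1` of `𝕋`. -/
def row11 : Matrix (Fin 1) (Fin 2) ℤ := fun _ _ => 1

/-- The unique (empty) `1 × 0` matrix, the unique morphism `0 ⟶ 1` of `𝕋`. -/
def zeroTo1 : Matrix (Fin 1) (Fin 0) ℤ := fun _ j => Fin.elim0 j

/-- The `1 × 1` matrix `(-1)`, a morphism `1 ⟶ 1` of `𝕋`. -/
def negMat : Matrix (Fin 1) (Fin 1) ℤ := fun _ _ => -1

/-- The `1 × n` matrix with `1` in position `i` and `0` elsewhere, a morphism `n ⟶ 1`. -/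
def unitRow (n : ℕ) (i : Fin n) : Matrix (Fin 1) (Fin n) ℤ :=
  fun _ j => if j = i then 1 else 0

/-- The action of a matrix on the values of `A`. -/
def act (A : ℕ ⥤ Type) {n k : ℕ} (P : Matrix (Fin k) (Fin n) ℤ) (z : A.obj n) : A.obj k :=
  A.map (show n ⟶ k from P) z

theorem act_mul (A : ℕ ⥤ Type) {n k m : ℕ} (Q : Matrix (Fin m) (Fin k) ℤ)
    (P : Matrix (Fin k) (Fin n) ℤ) (z : A.obj n) : act A (Q * P) z = act A Q (act A P z) := by
  have h := A.map_comp (show n ⟶ k from P) (show k ⟶ m from Q)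
  exact congrArg (fun f => f z) h

theorem unitRow_mul {n k : ℕ} (P : Matrix (Fin k) (Fin n) ℤ) (i : Fin k) :
    unitRow k i * P = fun _ j => P i j := by
  ext a j
  simp [Matrix.mul_apply, unitRow]

theorem unitRow_castSucc (n : ℕ) (i : Fin n) :
    unitRow (n + 1) i.castSucc = unitRow n i * proj₁ n 1 := by
  rw [unitRow_mul]
  ext a j
  simp [unitRow, proj₁, Fin.ext_iff]

theorem unitRow_last (n : ℕ) : unitRow (n + 1) (Fin.last n) = proj₂ n 1 := by
  ext a j
  simp [unitRow, proj₂, Fin.ext_iff]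

theorem comp_bijective (A : ℕ ⥤ Type)
    (h0 : Nonempty (Unique (A.obj 0)))
    (hp : ∀ n m : ℕ, Function.Bijective
      (fun z : A.obj (n + m) => (act A (proj₁ n m) z, act A (proj₂ n m) z))) (n : ℕ) :
    Function.Bijective (fun (z : A.obj n) (i : Fin n) => act A (unitRow n i) z) := by
  induction n with
  | zero =>
    obtain ⟨u⟩ := h0
    exact ⟨fun a b _ => Subsingleton.elim a b, fun f => ⟨u.default, funext fun i => i.elim0⟩⟩
  | succ n ih =>
    constructor
    · intro a b hab
      apply (hp n 1).1
      refine Prod.ext (ih.1 ?_) ?_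
      · funext i
        have := congrFun hab i.castSucc
        simpa only [unitRow_castSucc, act_mul] using this
      · have := congrFun hab (Fin.last n)
        simpa only [unitRow_last] using this
    · intro f
      obtain ⟨y, hy⟩ := ih.2 (fun i => f i.castSucc)
      obtain ⟨z, hz⟩ := (hp n 1).2 (y, f (Fin.last n))
      have h1 : act A (proj₁ n 1) z = y := congrArg Prod.fst hz
      have h2 : act A (proj₂ n 1) z = f (Fin.last n) := congrArg Prod.snd hz
      refine ⟨z, funext fun i => ?_⟩
      induction i using Fin.lastCases with
      | last => simpa only [unitRow_last] using h2
      | cast i =>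
        have := congrFun hy i
        simpa only [unitRow_castSucc, act_mul, h1] using this

theorem act_row (A : ℕ ⥤ Type) (h0 : Nonempty (Unique (A.obj 0)))
    [G : AddCommGroup (A.obj 1)]
    (hadd : ∀ z : A.obj 2, act A (proj₁ 1 1) z + act A (proj₂ 1 1) z = act A row11 z)
    (hzero : ∀ e : A.obj 0, 0 = act A zeroTo1 e) {n : ℕ} (z : A.obj n)
    (r : Fin n → ℤ) :
    act A (show Matrix (Fin 1) (Fin n) ℤ from fun _ j => r j) z
      = ∑ j, r j • act A (unitRow n j) z := by
  let φ : Matrix (Fin 1) (Fin n) ℤ →+ A.obj 1 :=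
    { toFun := fun r => act A r z
      map_zero' := by
        rw [hzero (act A 0 z), ← act_mul, Matrix.mul_zero]
      map_add' := by
        intro r s
        have h := hadd (act A (Matrix.of ![r 0, s 0]) z)
        have e1 : (proj₁ 1 1 : Matrix (Fin 1) (Fin 2) ℤ) * Matrix.of ![r 0, s 0] = r := by
          ext a j
          fin_cases a
          simp [Matrix.mul_apply, Fin.sum_univ_two, proj₁]
        have e2 : (proj₂ 1 1 : Matrix (Fin 1) (Fin 2) ℤ) * Matrix.of ![r 0, s 0] = s := by
          ext a j
          fin_cases a
          simp [Matrix.mul_apply, Fin.sum_univ_two, proj₂]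
        have e3 : row11 * Matrix.of ![r 0, s 0] = r + s := by
          ext a j
          fin_cases a
          simp [Matrix.mul_apply, Fin.sum_univ_two, row11]
        rw [← act_mul, ← act_mul, ← act_mul, e3] at h
        exact h.symm.trans (congrArg₂ (fun p q => act A p z + act A q z) e1 e2) }
  have h : (show Matrix (Fin 1) (Fin n) ℤ from fun _ j => r j) = ∑ j, r j • unitRow n j := by
    ext a j
    simp [Matrix.sum_apply, unitRow]
  rw [h]
  change φ _ = ∑ j, r j • φ _
  rw [map_sum]
  simp only [map_zsmul]

/-- Let `A : 𝕋 ⥤ Type` preserve finite products, and let `G` be the additive commutative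
group structure on `X := A.obj 1` induced by `A` (addition via the matrix `(1 1)`, zero
via the unique morphism `0 ⟶ 1`, negation via the matrix `(-1)`).  Then `A` is naturally
isomorphic to the functor `X̂ = hatF X`, a natural isomorphism being given in degree `n`
by the map `A.obj n → (Fin n → X)` whose `i`-th component is `A` applied to the `1 × n`
matrix with `1` in position `i` and `0` elsewhere. -/
theorem algebra_iso_hat (A : ℕ ⥤ Type)
    (h0 : Nonempty (Unique (A.obj 0)))
    (hp : ∀ n m : ℕ, Function.Bijective
      (fun z : A.obj (n + m) => (A.map (proj₁ n m) z, A.map (proj₂ n m) z)))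
    (G : AddCommGroup (A.obj 1))
    (hadd : ∀ (x y : A.obj 1) (z : A.obj 2),
      A.map (proj₁ 1 1) z = x → A.map (proj₂ 1 1) z = y →
      G.add x y = A.map row11 z)
    (hzero : ∀ e : A.obj 0, G.zero = A.map zeroTo1 e)
    (hneg : ∀ x : A.obj 1, G.neg x = A.map negMat x) :
    ∃ η : A ≅ @hatF (A.obj 1) G,
      ∀ (n : ℕ) (z : A.obj n) (i : Fin n),
        η.hom.app n z i = A.map (unitRow n i) z := by
  have hbij := comp_bijective A h0 hp
  have hrow := fun {n : ℕ} => act_row A h0 (G := G) (fun z => hadd _ _ z rfl rfl) hzero (n := n)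
  refine ⟨NatIso.ofComponents
    (fun n => (Equiv.ofBijective _ (hbij n)).toIso) ?_, fun n z i => rfl⟩
  intro n k P
  apply ConcreteCategory.hom_ext
  intro z
  funext i
  change act A (unitRow k i) (act A P z) =
    ∑ j, (show Matrix (Fin k) (Fin n) ℤ from P) i j • act A (unitRow n j) z
  rw [← act_mul, ← hrow, unitRow_mul]
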